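/- Let n ≥ 1. The assignment x_i ↦ 1 + y_i extends to a well-defined group homomorphism e: K_n^{ℤ/4} → (A_n^{ℤ/4})^× from the presented group K_n^{ℤ/4} to the unit group of A_n^{ℤ/4}; that is, every defining relator of K_n^{ℤ/4} (the iterated commutators with a repeated index and the fourth powers of generators) is sent to 1 under the substitution x_i ↦ 1 + y_i. -/

import Mathlib

noncomputable section

/-- The monomial `y_{i₁} y_{i₂} ⋯ y_{i_t}` in the free (tensor) algebra over `ℤ/4`
associated to a list of indices. -/
def mono (n : ℕ) (l : List (Fin n)) : FreeAlgebra (ZMod 4) (Fin n) :=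
  (l.map (FreeAlgebra.ι (ZMod 4))).prod

/-- The defining relations of `A_n^{ℤ/4}`: every monomial in which some generator repeats
(i.e. the index list is not `Nodup`) is identified with `0`.  Taking `RingQuot` of this
relation is exactly the quotient of the free (tensor) algebra over `ℤ/4` by the two-sided
ideal generated by these monomials. -/
inductive ARel (n : ℕ) : FreeAlgebra (ZMod 4) (Fin n) → FreeAlgebra (ZMod 4) (Fin n) → Prop
  | rel (l : List (Fin n)) (h : ¬ l.Nodup) : ARel n (mono n l) 0

/-- The algebra `A_n^{ℤ/4}`. -/
abbrev A (n : ℕ) : Type := RingQuot (ARel n)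

/-- The generators `y i` of `A_n^{ℤ/4}` (indexed by `Fin n`). -/
def y (n : ℕ) (i : Fin n) : A n := RingQuot.mkRingHom (ARel n) (FreeAlgebra.ι (ZMod 4) i)

/-- The augmentation ideal `I`: the two-sided ideal generated by the generators `y i`. -/
def Iaug (n : ℕ) : TwoSidedIdeal (A n) := TwoSidedIdeal.span (Set.range (y n))

/-- The ring commutator `[a,b] = a*b - b*a`. -/
def rc {R : Type*} [Ring R] (a b : R) : R := a * b - b * a

/-- The group commutator `[a,b] = a⁻¹ b⁻¹ a b`. -/
def gcomm {G : Type*} [Group G] (a b : G) : G := a⁻¹ * b⁻¹ * a * b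

/-- The defining relators of the Cohen group `K_n^{ℤ/4}`: left-normed iterated group
commutators `[[x_{i₁}, x_{i₂}], …, x_{i_t}]` (t ≥ 2) in which some index repeats, together
with the fourth powers `x_i⁴` of the generators. -/
def relsK (n : ℕ) : Set (FreeGroup (Fin n)) :=
  {w | ∃ (i₁ i₂ : Fin n) (rest : List (Fin n)), ¬ (i₁ :: i₂ :: rest).Nodup ∧
        w = rest.foldl (fun acc j => gcomm acc (FreeGroup.of j))
              (gcomm (FreeGroup.of i₁) (FreeGroup.of i₂))}
  ∪ {w | ∃ i : Fin n, w = (FreeGroup.of i) ^ 4}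

/-- The Cohen group `K_n^{ℤ/4}`, presented by generators `x_1, …, x_n` and the above
relators. -/
abbrev K (n : ℕ) : Type := PresentedGroup (relsK n)

/-- The generators `x i` of `K_n^{ℤ/4}` (indexed by `Fin n`). -/
def x (n : ℕ) (i : Fin n) : K n := PresentedGroup.of i

theorem mk_mono (n : ℕ) (l : List (Fin n)) :
    RingQuot.mkRingHom (ARel n) (mono n l) = (l.map (y n)).prod := by
  unfold mono
  rw [map_list_prod, List.map_map]
  rfl

theorem mono_zero (n : ℕ) (l : List (Fin n)) (h : ¬ l.Nodup) : (l.map (y n)).prod = 0 := by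
  rw [← mk_mono, RingQuot.mkRingHom_rel (ARel.rel l h), map_zero]

theorem absorb (n : ℕ) (i : Fin n) (f : FreeAlgebra (ZMod 4) (Fin n)) :
    ∀ b : A n, (∀ l : List (Fin n), b * (l.map (y n)).prod * y n i = 0) →
      ∀ l : List (Fin n),
        b * RingQuot.mkRingHom (ARel n) f * (l.map (y n)).prod * y n i = 0 := by
  induction f using FreeAlgebra.induction with
  | grade0 r =>
    intro b hb l
    have hc : b * RingQuot.mkRingHom (ARel n) (algebraMap (ZMod 4) _ r)
        = RingQuot.mkRingHom (ARel n) (algebraMap (ZMod 4) _ r) * b := by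
      obtain ⟨c, rfl⟩ := RingQuot.mkRingHom_surjective _ b
      rw [← map_mul, ← map_mul, Algebra.commutes]
    rw [hc, mul_assoc, mul_assoc, ← mul_assoc b, hb, mul_zero]
  | grade1 j =>
    intro b hb l
    have := hb (j :: l)
    rw [List.map_cons, List.prod_cons, ← mul_assoc b] at this
    exact this
  | mul p q hp hq =>
    intro b hb l
    rw [map_mul, ← mul_assoc b]
    exact hq _ (hp b hb) l
  | add p q hp hq =>
    intro b hb l
    rw [map_add, mul_add, add_mul, add_mul, hp b hb, hq b hb, add_zero]

theorem yay (n : ℕ) (i : Fin n) (a : A n) : y n i * a * y n i = 0 := by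
  obtain ⟨f, rfl⟩ := RingQuot.mkRingHom_surjective _ a
  have := absorb n i f (y n i) (fun l => by
    have := mono_zero n (i :: (l ++ [i])) (by simp)
    simpa [mul_assoc] using this) []
  simpa using this

theorem yy (n : ℕ) (i : Fin n) : y n i * y n i = 0 := by
  simpa using yay n i 1

/-- The unit `1 + y i`. -/
def uu (n : ℕ) (i : Fin n) : (A n)ˣ where
  val := 1 + y n i
  inv := 1 - y n i
  val_inv := by
    have := yy n i
    simp [mul_sub, add_mul, this]
  inv_val := by
    have := yy n i
    simp [mul_add, sub_mul, this]

theorem four_zero (n : ℕ) : (4 : A n) = 0 := by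
  have h : (4 : FreeAlgebra (ZMod 4) (Fin n)) = 0 := by
    have h4 : (4 : ZMod 4) = 0 := by decide
    have := congrArg (algebraMap (ZMod 4) (FreeAlgebra (ZMod 4) (Fin n))) h4
    rw [map_zero] at this
    rw [← this]
    exact (map_ofNat (algebraMap (ZMod 4) (FreeAlgebra (ZMod 4) (Fin n))) 4).symm
  have := congrArg (RingQuot.mkRingHom (ARel n)) h
  rw [map_zero] at this
  rw [← this]
  exact (map_ofNat (RingQuot.mkRingHom (ARel n)) 4).symm

theorem uu_pow (n : ℕ) (i : Fin n) : uu n i ^ 4 = 1 := by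
  ext
  have h2 : (1 + y n i) ^ 2 = 1 + 2 * y n i := by
    have : (1 + y n i) ^ 2 = 1 + 2 * y n i + y n i * y n i := by noncomm_ring
    rw [this, yy, add_zero]
  have h4 : (1 + y n i) ^ 4 = 1 + 4 * y n i + 4 * (y n i * y n i) := by
    have h22 : (1 + y n i) ^ 4 = ((1 + y n i) ^ 2) ^ 2 := (pow_mul _ 2 2)
    rw [h22, h2]
    noncomm_ring
  rw [yy, four_zero] at h4
  simpa [uu] using h4

theorem uu_comm (n : ℕ) (i : Fin n) (g : (A n)ˣ) : Commute (uu n i) (g * uu n i * g⁻¹) := by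
  ext
  have h : ((g * uu n i * g⁻¹ : (A n)ˣ) : A n) = 1 + g * y n i * (g⁻¹ : (A n)ˣ) := by
    simp [uu, mul_add, add_mul]
  have h1 : y n i * (g * y n i * (g⁻¹ : (A n)ˣ)) = 0 := by
    rw [← mul_assoc, ← mul_assoc, yay, zero_mul]
  have h2 : (g * y n i * (g⁻¹ : (A n)ˣ)) * y n i = 0 := by
    rw [mul_assoc, mul_assoc, ← mul_assoc (y n i), yay, mul_zero]
  rw [Units.val_mul, Units.val_mul _ (uu n i), h]
  change (1 + y n i) * _ = _ * (1 + y n i)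
  rw [mul_add, add_mul, add_mul, mul_add, add_mul, h1, add_mul, h2]
  simp only [one_mul, mul_one, add_zero]
  abel

theorem comm_closure {G : Type*} [Group G] (u : G) (h : ∀ g : G, Commute u (g * u * g⁻¹))
    (a : G) (ha : a ∈ Subgroup.normalClosure {u}) : Commute u a := by
  have hle : Subgroup.normalClosure {u} ≤ Subgroup.centralizer {u} := by
    unfold Subgroup.normalClosure
    rw [Subgroup.closure_le]
    intro b hb
    obtain ⟨c, hc, hcb⟩ := Group.mem_conjugatesOfSet_iff.1 hb
    obtain rfl : c = u := hc
    obtain ⟨g, rfl⟩ := isConj_iff.1 hcb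
    exact Subgroup.mem_centralizer_singleton_iff.2 (h g).eq.symm
  exact (Subgroup.mem_centralizer_singleton_iff.1 (hle ha)).symm

theorem gcomm_eq_one {G : Type*} [Group G] (a b : G) (h : Commute a b) : gcomm a b = 1 := by
  unfold gcomm
  rw [mul_assoc, h.eq, ← mul_inv_rev]
  simp

theorem gcomm_left {G : Type*} [Group G] (N : Subgroup G) [hN : N.Normal] (a b : G)
    (h : a ∈ N) : gcomm a b ∈ N := by
  have := N.mul_mem (N.inv_mem h) (hN.conj_mem a h b⁻¹)
  simpa [gcomm, mul_assoc] using this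

theorem gcomm_right {G : Type*} [Group G] (N : Subgroup G) [hN : N.Normal] (a b : G)
    (h : b ∈ N) : gcomm a b ∈ N := by
  have := N.mul_mem (hN.conj_mem b⁻¹ (N.inv_mem h) a⁻¹) h
  simpa [gcomm, mul_assoc] using this

theorem fold_one {G ι : Type*} [Group G] (u : ι → G) (l : List ι) :
    l.foldl (fun acc j => gcomm acc (u j)) 1 = 1 := by
  induction l with
  | nil => rfl
  | cons k l ih =>
    rw [List.foldl_cons, gcomm_eq_one _ _ (Commute.one_left _), ih]

theorem fold_main {G ι : Type*} [Group G] (u : ι → G)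
    (h : ∀ i, ∀ g : G, Commute (u i) (g * u i * g⁻¹)) (l : List ι) :
    ∀ (acc : G) (seen : List ι), (∀ j ∈ seen, acc ∈ Subgroup.normalClosure {u j}) →
      ((∃ j ∈ l, j ∈ seen) ∨ ¬ l.Nodup) →
      l.foldl (fun acc j => gcomm acc (u j)) acc = 1 := by
  induction l with
  | nil => intro acc seen _ h2; simp at h2
  | cons k l ih =>
    intro acc seen h1 h2
    rw [List.foldl_cons]
    by_cases hk : k ∈ seen
    · rw [gcomm_eq_one _ _ (comm_closure (u k) (h k) acc (h1 k hk)).symm, fold_one]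
    · apply ih _ (k :: seen)
      · intro j hj
        rcases List.mem_cons.1 hj with rfl | hj
        · exact gcomm_right _ _ _ (Subgroup.subset_normalClosure rfl)
        · exact gcomm_left _ _ _ (h1 j hj)
      · rw [List.nodup_cons] at h2
        rcases h2 with ⟨j, hj, hs⟩ | h2
        · rcases List.mem_cons.1 hj with rfl | hj
          · exact absurd hs hk
          · exact Or.inl ⟨j, hj, List.mem_cons_of_mem _ hs⟩
        · by_cases hkl : k ∈ l
          · exact Or.inl ⟨k, hkl, List.mem_cons_self⟩
          · exact Or.inr fun hl => h2 ⟨hkl, hl⟩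

theorem map_fold {G H ι : Type*} [Group G] [Group H] (φ : G →* H) (v : ι → G) (l : List ι) :
    ∀ a : G, φ (l.foldl (fun acc j => gcomm acc (v j)) a)
      = l.foldl (fun acc j => gcomm acc (φ (v j))) (φ a) := by
  induction l with
  | nil => intro a; rfl
  | cons k l ih =>
    intro a
    rw [List.foldl_cons, List.foldl_cons, ih]
    simp [gcomm]

theorem rels_one (n : ℕ) : ∀ r ∈ relsK n, FreeGroup.lift (uu n) r = 1 := by
  rintro r (⟨i₁, i₂, rest, hnd, rfl⟩ | ⟨i, rfl⟩)
  · have := map_fold (FreeGroup.lift (uu n)) FreeGroup.of (i₂ :: rest) (FreeGroup.of i₁)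
    rw [List.foldl_cons] at this
    rw [this]
    simp only [FreeGroup.lift_apply_of]
    apply fold_main (uu n) (uu_comm n) (i₂ :: rest) _ [i₁]
    · intro j hj
      obtain rfl := List.mem_singleton.1 hj
      exact Subgroup.subset_normalClosure rfl
    · by_cases hm : i₁ ∈ i₂ :: rest
      · exact Or.inl ⟨i₁, hm, List.mem_singleton_self _⟩
      · exact Or.inr fun hl => hnd (List.nodup_cons.2 ⟨hm, hl⟩)
  · rw [map_pow, FreeGroup.lift_apply_of, uu_pow]

/-- The assignment `x_i ↦ 1 + y_i` extends to a well-defined group homomorphism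
`e : K_n^{ℤ/4} → (A_n^{ℤ/4})ˣ`; i.e. there is a group homomorphism of the presented group
`K_n^{ℤ/4}` into the unit group of `A_n^{ℤ/4}` sending each generator `x_i` to the unit
`1 + y_i` (equivalently, every defining relator is sent to `1`). -/
theorem stmt_12 (n : ℕ) (hn : 1 ≤ n) :
    ∃ e : K n →* (A n)ˣ, ∀ i : Fin n, ((e (x n i) : (A n)ˣ) : A n) = 1 + y n i := by
  refine ⟨PresentedGroup.toGroup (rels_one n), fun i => ?_⟩
  unfold x
  rw [PresentedGroup.toGroup.of]
  rfl
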